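/- Let N ∈ ℕ be odd and let f : ℝ → ℂ be a continuous 2π-periodic function. For n ∈ ℤ set x_n = 2πn/N. Then for every x ∈ ℝ that is not one of the nodes (x ≢ x_j mod 2π for all j), the symmetric limit lim_{M→∞} Σ_{|n|≤M} f(x_n) sinc(N(x − x_n)/(2π)) exists and equals (1/N) Σ_{n=0}^{N−1} f(x_n) · sin(N(x − x_n)/2) / sin((x − x_n)/2). -/

import Mathlib

open scoped BigOperators

/-- The normalized sinc function: `sinc x = sin (π x) / (π x)` for `x ≠ 0`, `sinc 0 = 1`. -/
noncomputable def sinc (x : ℝ) : ℝ :=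
  if x = 0 then 1 else Real.sin (Real.pi * x) / (Real.pi * x)

/-- The equispaced node `x_n = 2πn/N`. -/
noncomputable def node (N : ℕ) (n : ℤ) : ℝ := 2 * Real.pi * (n : ℝ) / (N : ℝ)

/-- The trigonometric polynomial interpolant of `f` at the equispaced nodes
`x_j = 2πj/N`, `j = 0, …, N−1` (odd-`N` case):
`P_N f (x) = (1/N) ∑_{|n| ≤ (N−1)/2} ∑_{j=0}^{N−1} f(x_j) exp(i n (x − x_j))`. -/
noncomputable def trigInterp (N : ℕ) (f : ℝ → ℂ) (x : ℝ) : ℂ :=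
  (1 / (N : ℂ)) *
    ∑ n ∈ Finset.Icc (-(((N : ℤ) - 1) / 2)) (((N : ℤ) - 1) / 2),
      ∑ j ∈ Finset.range N,
        f (node N j) * Complex.exp (Complex.I * (n : ℂ) * ((x : ℂ) - (node N j : ℂ)))

/-- The symmetric partial sums `∑_{|n| ≤ M} f(x_n) sinc (N (x − x_n) / (2π))` of the
sinc interpolation series. -/
noncomputable def sincPartial (N : ℕ) (f : ℝ → ℂ) (x : ℝ) (M : ℕ) : ℂ :=
  ∑ n ∈ Finset.Icc (-(M : ℤ)) (M : ℤ),
    ((sinc ((N : ℝ) * (x - node N n) / (2 * Real.pi)) : ℝ) : ℂ) * f (node N n)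

open Filter Topology Complex

/-- Enlarging a symmetric half-open integer interval by one on each side adds two terms. -/
lemma sum_Ico_neg_succ {E : Type*} [AddCommMonoid E] (h : ℤ → E) (K : ℕ) :
    ∑ n ∈ Finset.Ico (-((K + 1 : ℕ) : ℤ)) ((K + 1 : ℕ) : ℤ), h n =
      ∑ n ∈ Finset.Ico (-(K : ℤ)) (K : ℤ), h n + (h K + h (-((K : ℤ) + 1))) := by
  have hset : Finset.Ico (-((K + 1 : ℕ) : ℤ)) ((K + 1 : ℕ) : ℤ) =
      insert (-((K : ℤ) + 1)) (insert (K : ℤ) (Finset.Ico (-(K : ℤ)) (K : ℤ))) := by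
    ext n
    simp only [Finset.mem_Ico, Finset.mem_insert]
    push_cast
    omega
  rw [hset, Finset.sum_insert, Finset.sum_insert]
  · rw [← add_assoc, add_comm, add_comm (h _)]
  · simp
  · simp only [Finset.mem_Ico, Finset.mem_insert]
    omega

/-- The sum over the closed symmetric interval has one more term than the half-open one. -/
lemma sum_Icc_neg_eq_sum_Ico_add {E : Type*} [AddCommMonoid E] (h : ℤ → E) (M : ℕ) :
    ∑ n ∈ Finset.Icc (-(M : ℤ)) (M : ℤ), h n =
      ∑ n ∈ Finset.Ico (-(M : ℤ)) (M : ℤ), h n + h M := by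
  rw [add_comm, Finset.add_sum_Ico_eq_sum_Icc (by omega)]

/-- Splitting a sum over `[-KN, KN)` into residue classes modulo `N`. -/
lemma sum_Ico_mul_eq_sum_residues {E : Type*} [AddCommMonoid E] (h : ℤ → E) {N : ℕ} (hN : 0 < N)
    (K : ℕ) :
    ∑ n ∈ Finset.Ico (-((N * K : ℕ) : ℤ)) ((N * K : ℕ) : ℤ), h n =
      ∑ j ∈ Finset.range N, ∑ k ∈ Finset.Ico (-(K : ℤ)) (K : ℤ), h (j + k * N) := by
  have hN' : (0 : ℤ) < N := by exact_mod_cast hN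
  rw [← Finset.sum_product']
  refine Finset.sum_nbij' (fun n => ((n % N).toNat, n / N)) (fun p => (p.1 : ℤ) + p.2 * N)
    ?_ ?_ ?_ ?_ ?_
  · intro n hn
    simp only [Finset.mem_Ico, Finset.mem_product, Finset.mem_range] at hn ⊢
    push_cast at hn
    have h0 := Int.emod_nonneg n hN'.ne'
    have h1 := Int.emod_lt_of_pos n hN'
    refine ⟨by omega, ?_, ?_⟩
    · rw [Int.le_ediv_iff_mul_le hN']
      linarith
    · rw [Int.ediv_lt_iff_lt_mul hN']
      linarith
  · rintro ⟨j, k⟩ hp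
    simp only [Finset.mem_Ico, Finset.mem_product, Finset.mem_range] at hp ⊢
    obtain ⟨hj, hk, hk'⟩ := hp
    have hj' : (j : ℤ) < N := by exact_mod_cast hj
    push_cast
    constructor <;> nlinarith
  · intro n _
    have h0 := Int.emod_nonneg n hN'.ne'
    have := Int.emod_add_mul_ediv n N
    simp only [Int.toNat_of_nonneg h0]
    linarith
  · rintro ⟨j, k⟩ hp
    simp only [Finset.mem_Ico, Finset.mem_product, Finset.mem_range] at hp
    have hj' : (j : ℤ) < N := by exact_mod_cast hp.1
    have hmod : ((j : ℤ) + k * N) % N = j := by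
      rw [Int.add_mul_emod_self_right, Int.emod_eq_of_lt (by omega) hj']
    have hdiv : ((j : ℤ) + k * N) / N = k := by
      rw [Int.add_mul_ediv_right _ _ hN'.ne', Int.ediv_eq_zero_of_lt (by omega) hj', zero_add]
    simp [hmod, hdiv]
  · intro n _
    have h0 := Int.emod_nonneg n hN'.ne'
    have := Int.emod_add_mul_ediv n N
    simp only [Int.toNat_of_nonneg h0]
    congr 1
    linarith

/-- A sequence with vanishing increments converges as soon as it converges along the multiples
of a positive integer. -/
lemma tendsto_of_tendsto_mul_of_tendsto_sub {E : Type*} [SeminormedAddCommGroup E] {u : ℕ → E}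
    {L : E} {N : ℕ} (hN : 0 < N) (hu : Tendsto (fun n => u (n + 1) - u n) atTop (𝓝 0))
    (hL : Tendsto (fun K => u (N * K)) atTop (𝓝 L)) : Tendsto u atTop (𝓝 L) := by
  have hmul : Tendsto (fun K => N * K) atTop atTop := tendsto_id.const_mul_atTop' hN
  have hr : ∀ r, Tendsto (fun K => u (N * K + r)) atTop (𝓝 L) := by
    intro r
    induction r with
    | zero => simpa using hL
    | succ r ih =>
      have := (hu.comp (tendsto_atTop_mono (fun _ => Nat.le_add_right _ r) hmul)).add ih
      simpa only [Function.comp_def, sub_add_cancel, zero_add, add_assoc] using this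
  intro s hs
  have hall : ∀ᶠ K in atTop, ∀ r ∈ Finset.range N, u (N * K + r) ∈ s :=
    (Filter.eventually_all_finset _).2 fun r _ => hr r hs
  have hdiv := (Nat.tendsto_div_const_atTop hN.ne').eventually hall
  rw [Filter.mem_map]
  filter_upwards [hdiv] with M hM
  have := hM (M % N) (Finset.mem_range.2 (Nat.mod_lt _ hN))
  rwa [Nat.div_add_mod] at this

/-- The alternating partial fraction expansion of the cosecant, with paired terms. -/
lemma tendsto_sum_alternating_cotTerm {s : ℂ} (hs : s ∈ integerComplement) :
    Tendsto (fun n : ℕ => ∑ m ∈ Finset.range n, (-1) ^ (m + 1) * cotTerm s m) atTop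
      (𝓝 (Real.pi / sin (Real.pi * s) - 1 / s)) := by
  have hs2 : s / 2 ∈ integerComplement := by
    rw [mem_integerComplement_iff] at hs ⊢
    rintro ⟨n, hn⟩
    exact hs ⟨2 * n, by push_cast; rw [hn]; ring⟩
  have hsum : Summable fun m : ℕ => (-1 : ℂ) ^ (m + 1) * cotTerm s m := by
    refine Summable.of_norm ?_
    simpa using (summable_cotTerm hs).norm
  have heven : ∀ L : ℕ, ∑ m ∈ Finset.range (2 * L), (-1 : ℂ) ^ (m + 1) * cotTerm s m =
      ∑ l ∈ Finset.range L, cotTerm (s / 2) l - ∑ m ∈ Finset.range (2 * L), cotTerm s m := by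
    intro L
    induction L with
    | zero => simp
    | succ L ih =>
      have hhalf : cotTerm (s / 2) L = 2 * cotTerm s (2 * L + 1) := by
        have h1 : s / 2 - ((L : ℂ) + 1) = (s - ((2 * L + 1 : ℕ) + 1)) / 2 := by push_cast; ring
        have h2 : s / 2 + ((L : ℂ) + 1) = (s + ((2 * L + 1 : ℕ) + 1)) / 2 := by push_cast; ring
        simp only [cotTerm]
        rw [h1, h2, one_div_div, one_div_div]
        ring
      rw [mul_add_one, Finset.sum_range_succ, Finset.sum_range_succ, ih, Finset.sum_range_succ,
        Finset.sum_range_succ _ (2 * L + 1), Finset.sum_range_succ _ (2 * L), hhalf]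
      simp only [pow_succ, pow_mul]
      ring
  have hmul : Tendsto (fun L => 2 * L) atTop (atTop : Filter ℕ) :=
    tendsto_id.const_mul_atTop' two_pos
  have hlim := (tendsto_logDeriv_euler_cot_sub hs2).sub
    ((tendsto_logDeriv_euler_cot_sub hs).comp hmul)
  have hval : Real.pi * cot (Real.pi * (s / 2)) - 1 / (s / 2) -
      (Real.pi * cot (Real.pi * s) - 1 / s) = Real.pi / sin (Real.pi * s) - 1 / s := by
    have hsin := sin_pi_mul_ne_zero hs
    have hsin2 := sin_pi_mul_ne_zero hs2
    have hdouble : (Real.pi : ℂ) * s = 2 * (Real.pi * (s / 2)) := by ring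
    have hcot : cot (Real.pi * (s / 2)) - cot (Real.pi * s) = 1 / sin (Real.pi * s) := by
      rw [hdouble] at hsin ⊢
      rw [Complex.cot, Complex.cot, Complex.cos_two_mul]
      rw [Complex.sin_two_mul] at hsin ⊢
      have hcos := right_ne_zero_of_mul hsin
      field_simp
      ring
    have : 1 / (s / 2) = 2 / s := one_div_div _ _
    rw [this, div_eq_mul_one_div (Real.pi : ℂ) (sin _), ← hcot]
    ring
  rw [hval] at hlim
  have hfull := hsum.hasSum.tendsto_sum_nat
  have hsub : Tendsto (fun L : ℕ => ∑ m ∈ Finset.range (2 * L), (-1 : ℂ) ^ (m + 1) * cotTerm s m)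
      atTop (𝓝 (Real.pi / sin (Real.pi * s) - 1 / s)) := by
    simpa only [heven, Function.comp_def] using hlim
  rwa [tendsto_nhds_unique (hfull.comp hmul) hsub] at hfull

/-- The alternating partial fraction expansion of the cosecant over symmetric intervals. -/
lemma tendsto_sum_Ico_alternating_inv {s : ℂ} (hs : s ∈ integerComplement) :
    Tendsto (fun K : ℕ => ∑ k ∈ Finset.Ico (-(K : ℤ)) (K : ℤ), (-1 : ℂ) ^ k * (s - k)⁻¹) atTop
      (𝓝 (Real.pi / sin (Real.pi * s))) := by
  have hsum : ∀ K : ℕ, ∑ k ∈ Finset.Ico (-(K : ℤ)) (K : ℤ), (-1 : ℂ) ^ k * (s - k)⁻¹ =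
      1 / s + ∑ m ∈ Finset.range K, (-1) ^ (m + 1) * cotTerm s m - (-1) ^ K * (s - K)⁻¹ := by
    intro K
    induction K with
    | zero => simp
    | succ K ih =>
      rw [sum_Ico_neg_succ, ih, Finset.sum_range_succ]
      have : (-1 : ℂ) ^ (-((K : ℤ) + 1)) = (-1) ^ (K + 1) := by
        rw [zpow_neg, ← inv_zpow, inv_neg_one]
        exact_mod_cast rfl
      rw [this]
      push_cast
      simp only [cotTerm, one_div, zpow_natCast, sub_neg_eq_add]
      ring
  have hzero : Tendsto (fun K : ℕ => (-1 : ℂ) ^ K * (s - K)⁻¹) atTop (𝓝 0) := by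
    rw [tendsto_zero_iff_norm_tendsto_zero]
    have : Tendsto (fun K : ℕ => (s - K)⁻¹) atTop (𝓝 0) :=
      tendsto_inv₀_cobounded.comp
        ((tendsto_const_sub_cobounded s).comp tendsto_natCast_atTop_cobounded)
    simpa using this.norm
  simp only [hsum]
  have := ((tendsto_sum_alternating_cotTerm hs).const_add (1 / s)).sub hzero
  simpa using this

/-- Decay of the sinc function. -/
lemma tendsto_sinc_cobounded : Tendsto sinc (Bornology.cobounded ℝ) (𝓝 0) := by
  have hbound : ∀ y : ℝ, y ≠ 0 → ‖sinc y‖ ≤ ‖(Real.pi * y)⁻¹‖ := by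
    intro y hy
    rw [sinc, if_neg hy, div_eq_mul_inv, norm_mul]
    exact mul_le_of_le_one_left (norm_nonneg _) (Real.abs_sin_le_one _)
  refine squeeze_zero_norm' (a := fun y => ‖(Real.pi * y)⁻¹‖) ?_ ?_
  · filter_upwards [Bornology.eventually_ne_cobounded (0 : ℝ)] with y hy using hbound y hy
  · rw [← tendsto_zero_iff_norm_tendsto_zero]
    exact tendsto_inv₀_cobounded.comp (tendsto_mul_left_cobounded Real.pi_ne_zero)

lemma node_add_mul {N : ℕ} (hN : N ≠ 0) (j k : ℤ) :
    node N (j + k * N) = node N j + k * (2 * Real.pi) := by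
  have : (N : ℝ) ≠ 0 := by exact_mod_cast hN
  simp only [node]
  push_cast
  field_simp

/-- For odd `N`, a term of the sinc series in terms of the signed distance
`s = (x - x_j) / (2π)` to the node it is congruent to. -/
lemma sinc_mul_sub_int {N : ℕ} (hN : Odd N) {s : ℝ} {k : ℤ} (hs : s ≠ k) :
    sinc (N * (s - k)) =
      Real.sin (Real.pi * (N * s)) / (Real.pi * N) * ((-1) ^ k * (s - k)⁻¹) := by
  have hN0 : (N : ℝ) ≠ 0 := by exact_mod_cast hN.pos.ne'
  have hsk : s - k ≠ 0 := sub_ne_zero.2 hs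
  have harg : Real.pi * (N * (s - k)) = Real.pi * (N * s) - ((N * k : ℤ) : ℝ) * Real.pi := by
    push_cast; ring
  have hsign : (-1 : ℝ) ^ ((N : ℤ) * k) = (-1) ^ k := by
    rw [zpow_mul, zpow_natCast, hN.neg_one_pow]
  rw [sinc, if_neg (mul_ne_zero hN0 hsk)]
  nth_rewrite 1 [harg]
  rw [Real.sin_sub_int_mul_pi, hsign]
  field_simp

/-- For odd `N`, a continuous `2π`-periodic `f`, and a point `x` not congruent to any node
`x_j = 2πj/N` modulo `2π`, the symmetric sinc interpolation series converges and equals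
the Dirichlet-kernel form `(1/N) ∑_{n=0}^{N−1} f(x_n) sin(N(x−x_n)/2)/sin((x−x_n)/2)`. -/
theorem sinc_series_eq_dirichlet (N : ℕ) (hN : Odd N) (f : ℝ → ℂ)
    (hf : Continuous f) (hper : Function.Periodic f (2 * Real.pi)) (x : ℝ)
    (hx : ∀ m : ℤ, x ≠ node N m) :
    Filter.Tendsto (sincPartial N f x) Filter.atTop
      (nhds ((1 / (N : ℂ)) * ∑ n ∈ Finset.range N,
        f (node N n) *
          ((Real.sin ((N : ℝ) * (x - node N n) / 2) / Real.sin ((x - node N n) / 2) : ℝ) : ℂ))) := by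
  have hN0 : N ≠ 0 := hN.pos.ne'
  have hNR : (N : ℝ) ≠ 0 := by exact_mod_cast hN0
  have hpi := Real.pi_ne_zero
  set h : ℤ → ℂ := fun n =>
    ((sinc ((N : ℝ) * (x - node N n) / (2 * Real.pi)) : ℝ) : ℂ) * f (node N n) with h_def
  have hzero : Tendsto h (atBot ⊔ atTop) (𝓝 0) := by
    obtain ⟨C, hC⟩ := (hper.isBounded_of_continuous (by positivity) hf).exists_norm_le
    have harg : ∀ n : ℤ, (N : ℝ) * (x - node N n) / (2 * Real.pi) =
        N * x / (2 * Real.pi) - n := by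
      intro n
      simp only [node]
      field_simp
    have hsinc : Tendsto (fun n : ℤ => ((sinc ((N : ℝ) * (x - node N n) / (2 * Real.pi)) : ℝ) : ℂ))
        (atBot ⊔ atTop) (𝓝 0) := by
      have := tendsto_sinc_cobounded.comp ((tendsto_const_sub_cobounded
        (N * x / (2 * Real.pi))).comp tendsto_intCast_atBot_sup_atTop_cobounded)
      simp only [harg]
      exact_mod_cast (continuous_ofReal.tendsto 0).comp this
    exact hsinc.zero_mul_isBoundedUnder_le
      (isBoundedUnder_of ⟨C, fun n => hC _ (Set.mem_range_self (node N n))⟩)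
  have hpos : Tendsto (fun M : ℕ => h M) atTop (𝓝 0) :=
    (hzero.mono_left le_sup_right).comp tendsto_natCast_atTop_atTop
  have hneg : Tendsto (fun M : ℕ => h (-((M : ℤ) + 1))) atTop (𝓝 0) :=
    (hzero.mono_left le_sup_left).comp (tendsto_neg_atTop_atBot.comp
      (tendsto_atTop_add_const_right _ 1 tendsto_natCast_atTop_atTop))
  have hclass : ∀ j : ℕ, Tendsto
      (fun K : ℕ => ∑ k ∈ Finset.Ico (-(K : ℤ)) (K : ℤ), h (j + k * N)) atTop
      (𝓝 (1 / (N : ℂ) * (f (node N j) *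
        ((Real.sin ((N : ℝ) * (x - node N j) / 2) / Real.sin ((x - node N j) / 2) : ℝ) : ℂ)))) := by
    intro j
    obtain ⟨s, rfl⟩ : ∃ s : ℝ, x = node N j + 2 * Real.pi * s :=
      ⟨(x - node N j) / (2 * Real.pi), by field_simp; ring⟩
    have hs : ∀ k : ℤ, s ≠ k := by
      rintro k rfl
      exact hx (j + k * N) (by rw [node_add_mul hN0]; ring)
    have hsC : (s : ℂ) ∈ integerComplement := by
      rw [mem_integerComplement_iff]
      rintro ⟨k, hk⟩
      exact hs k (by exact_mod_cast hk.symm)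
    have hterm : ∀ k : ℤ, h (j + k * N) =
        f (node N j) * ((Real.sin (Real.pi * (N * s)) / (Real.pi * N) : ℝ) : ℂ) *
          ((-1 : ℂ) ^ k * ((s : ℂ) - k)⁻¹) := by
      intro k
      have harg : (N : ℝ) * (node N j + 2 * Real.pi * s - node N (j + k * N)) / (2 * Real.pi) =
          N * (s - k) := by
        rw [node_add_mul hN0]
        field_simp
        ring
      simp only [h_def]
      rw [harg, sinc_mul_sub_int hN (hs k), node_add_mul hN0, hper.int_mul k]
      push_cast
      ring
    simp only [hterm, ← Finset.mul_sum]
    convert (tendsto_sum_Ico_alternating_inv hsC).const_mul _ using 2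
    have h1 : (N : ℝ) * (node N j + 2 * Real.pi * s - node N j) / 2 = Real.pi * (N * s) := by ring
    have h2 : (node N j + 2 * Real.pi * s - node N j) / 2 = Real.pi * s := by ring
    have hpiC : (Real.pi : ℂ) ≠ 0 := by exact_mod_cast hpi
    rw [h1, h2]
    push_cast
    field_simp
  have hIco : Tendsto (fun M : ℕ => ∑ n ∈ Finset.Ico (-(M : ℤ)) (M : ℤ), h n) atTop
      (𝓝 (1 / (N : ℂ) * ∑ n ∈ Finset.range N, f (node N n) *
        ((Real.sin ((N : ℝ) * (x - node N n) / 2) / Real.sin ((x - node N n) / 2) : ℝ) : ℂ))) := by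
    refine tendsto_of_tendsto_mul_of_tendsto_sub hN.pos ?_ ?_
    · simpa only [sum_Ico_neg_succ, add_sub_cancel_left, add_zero] using hpos.add hneg
    · simp only [sum_Ico_mul_eq_sum_residues h hN.pos, Finset.mul_sum]
      exact tendsto_finsetSum _ fun j _ => hclass j
  have hIcc := hIco.add hpos
  simp only [← sum_Icc_neg_eq_sum_Ico_add, add_zero] at hIcc
  exact hIcc
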